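/- arXiv:2204.10722 — 5 statements merged into one kernel-verified Lean document; each statement's English description precedes it below -/
import Mathlib

section
/- Let A ∈ ℝ^{m×ℓ}, B ∈ ℝ^{ℓ×n} with rank(A) = rank(B) = ℓ, and b ∈ ran(AB). Let f : ℝ^n → ℝ be γ-strongly convex with differentiable conjugate f*, let x⋆ be the unique solution of: minimize f(x) subject to ABx = b, and assume there exists ν > 0 such that D_{f,z}(x, x⋆) ≤ (1/ν)‖B(x − x⋆)‖₂² for all x ∈ ℝ^n and all z ∈ ∂f(x) ∩ ran(Bᵀ). Set α = 1 − σ_min²(A)/‖A‖_F² and β = 1 − γν/(2‖B‖_F²). Then for every δ > 0 and every k ≥ 1, the iterates of the RK-RRK algorithm satisfy E[D_{f,z^{(k)}}(x^{(k)}, x⋆)] ≤ (1 + δ/γ)^k β^k D_{f,z^{(0)}}(x^{(0)}, x⋆) + ((δ+γ)γ/(2δ‖B‖_F²)) ‖A†b‖₂² · Σ_{i=0}^{k−1} α^{k−i} (1 + δ/γ)^i β^i. -/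
open Finset

noncomputable section

/-- Euclidean inner product on `ℝ^k`. -/
def dotp {k : ℕ} (x y : Fin k → ℝ) : ℝ := ∑ i, x i * y i

/-- Squared Euclidean norm on `ℝ^k`. -/
def sqnorm {k : ℕ} (x : Fin k → ℝ) : ℝ := ∑ i, (x i) ^ 2

/-- Subdifferential of `f` at `x`. -/
def subdiff {k : ℕ} (f : (Fin k → ℝ) → ℝ) (x : Fin k → ℝ) : Set (Fin k → ℝ) :=
  {z | ∀ y, f y ≥ f x + dotp z (y - x)}

/-- `f` is `γ`-strongly convex. -/
def StrongConvexWith {k : ℕ} (γ : ℝ) (f : (Fin k → ℝ) → ℝ) : Prop :=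
  ∀ x y z, z ∈ subdiff f x → f y ≥ f x + dotp z (y - x) + γ / 2 * sqnorm (y - x)

/-- Bregman distance between `x` and `y` with respect to `f` and `z ∈ ∂f(x)`. -/
def Dbreg {k : ℕ} (f : (Fin k → ℝ) → ℝ) (z x y : Fin k → ℝ) : ℝ :=
  f y - f x - dotp z (y - x)

open Matrix

/-- Squared Frobenius norm of a matrix. -/
def frobSq {m l : ℕ} (A : Matrix (Fin m) (Fin l) ℝ) : ℝ := ∑ i, ∑ j, (A i j) ^ 2

/-- Square of the minimum singular value of a (full column rank) matrix. -/
def sminSq {m l : ℕ} (A : Matrix (Fin m) (Fin l) ℝ) : ℝ :=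
  sInf {c : ℝ | ∃ v : Fin l → ℝ, sqnorm v = 1 ∧ c = sqnorm (A.mulVec v)}

/-- `P` is the Moore–Penrose pseudoinverse of `A` (Penrose conditions). -/
def IsMoorePenrose {m l : ℕ} (A : Matrix (Fin m) (Fin l) ℝ)
    (P : Matrix (Fin l) (Fin m) ℝ) : Prop :=
  A * P * A = A ∧ P * A * P = P ∧ (A * P)ᵀ = A * P ∧ (P * A)ᵀ = P * A

/-- One step of the RK-RRK algorithm: given the choice `c = (j, i)` of a row of `A`
and a row of `B`, and the current state `s = (y, z)`, perform one RK step for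
`A y = b` followed by one RRK step for `B x = y` (with `x = Df z`). -/
def rkrrkStep {m l n : ℕ} (A : Matrix (Fin m) (Fin l) ℝ) (B : Matrix (Fin l) (Fin n) ℝ)
    (b : Fin m → ℝ) (γ : ℝ) (Df : (Fin n → ℝ) → (Fin n → ℝ)) (c : Fin m × Fin l)
    (s : (Fin l → ℝ) × (Fin n → ℝ)) : (Fin l → ℝ) × (Fin n → ℝ) :=
  let y' := s.1 - ((dotp (A c.1) s.1 - b c.1) / sqnorm (A c.1)) • A c.1
  (y', s.2 - (γ * (dotp (B c.2) (Df s.2) - y' c.2) / sqnorm (B c.2)) • B c.2)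

/-- The RK-RRK iterate obtained from initial state `(y0, z0)` by applying one
step for each entry of the list of index choices. -/
def rkrrkIter {m l n : ℕ} (A : Matrix (Fin m) (Fin l) ℝ) (B : Matrix (Fin l) (Fin n) ℝ)
    (b : Fin m → ℝ) (γ : ℝ) (Df : (Fin n → ℝ) → (Fin n → ℝ))
    (y0 : Fin l → ℝ) (z0 : Fin n → ℝ) :
    List (Fin m × Fin l) → (Fin l → ℝ) × (Fin n → ℝ)
  | [] => (y0, z0)
  | c :: cs => rkrrkStep A B b γ Df c (rkrrkIter A B b γ Df y0 z0 cs)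

lemma dotp_eq_dotProduct {k : ℕ} (x y : Fin k → ℝ) : dotp x y = x ⬝ᵥ y := rfl

lemma sqnorm_eq_dotProduct {k : ℕ} (x : Fin k → ℝ) : sqnorm x = x ⬝ᵥ x :=
  Finset.sum_congr rfl fun i _ => pow_two (x i)

lemma sqnorm_nonneg {k : ℕ} (x : Fin k → ℝ) : 0 ≤ sqnorm x :=
  Finset.sum_nonneg fun i _ => sq_nonneg (x i)

lemma sqnorm_eq_zero {k : ℕ} {x : Fin k → ℝ} : sqnorm x = 0 ↔ x = 0 := by
  rw [sqnorm_eq_dotProduct, dotProduct_self_eq_zero]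

lemma sqnorm_smul {k : ℕ} (c : ℝ) (x : Fin k → ℝ) : sqnorm (c • x) = c ^ 2 * sqnorm x := by
  simp only [sqnorm_eq_dotProduct, smul_dotProduct, dotProduct_smul, smul_eq_mul]
  ring

lemma frobSq_eq_sum_sqnorm {m l : ℕ} (A : Matrix (Fin m) (Fin l) ℝ) :
    frobSq A = ∑ j, sqnorm (A j) := rfl

lemma exists_row_ne_zero {m l r : ℕ} [NeZero r] {A : Matrix (Fin m) (Fin l) ℝ}
    (hA : A.rank = r) : ∃ j, A j ≠ 0 := by
  by_contra! h
  have : A = 0 := funext h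
  rw [this, Matrix.rank_zero] at hA
  exact NeZero.ne r hA.symm

lemma frobSq_pos {m l : ℕ} {A : Matrix (Fin m) (Fin l) ℝ} {j : Fin m} (hj : A j ≠ 0) :
    0 < frobSq A := by
  rw [frobSq_eq_sum_sqnorm]
  exact Finset.sum_pos' (fun i _ => sqnorm_nonneg _) ⟨j, Finset.mem_univ _,
    lt_of_le_of_ne (sqnorm_nonneg _) fun h => hj (sqnorm_eq_zero.1 h.symm)⟩

lemma sum_sqnorm_div_frobSq {m l : ℕ} {A : Matrix (Fin m) (Fin l) ℝ} (hA : 0 < frobSq A) :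
    ∑ j, sqnorm (A j) / frobSq A = 1 := by
  rw [← Finset.sum_div, ← frobSq_eq_sum_sqnorm, div_self hA.ne']

lemma mulVec_injective_of_rank_eq {m l : ℕ} {A : Matrix (Fin m) (Fin l) ℝ} (hA : A.rank = l) :
    Function.Injective A.mulVec := by
  have h := LinearMap.finrank_range_add_finrank_ker A.mulVecLin
  have h' : Module.finrank ℝ (LinearMap.range A.mulVecLin) = l := hA
  rw [h', Module.finrank_fin_fun] at h
  have hker : LinearMap.ker A.mulVecLin = ⊥ := Submodule.finrank_eq_zero.1 (by omega)
  exact LinearMap.ker_eq_bot.1 hker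

lemma IsMoorePenrose.mulVec_mulVec {m l : ℕ} {A : Matrix (Fin m) (Fin l) ℝ}
    {P : Matrix (Fin l) (Fin m) ℝ} (hP : IsMoorePenrose A P) (hA : A.rank = l)
    (v : Fin l → ℝ) : P.mulVec (A.mulVec v) = v := by
  apply mulVec_injective_of_rank_eq hA
  rw [Matrix.mulVec_mulVec, Matrix.mulVec_mulVec, hP.1]

lemma sminSq_mul_sqnorm_le {m l : ℕ} (A : Matrix (Fin m) (Fin l) ℝ) (v : Fin l → ℝ) :
    sminSq A * sqnorm v ≤ sqnorm (A.mulVec v) := by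
  rcases (sqnorm_nonneg v).eq_or_lt with h | h
  · rw [← h, mul_zero]
    exact sqnorm_nonneg _
  · have hc : ((√(sqnorm v))⁻¹) ^ 2 = (sqnorm v)⁻¹ := by
      rw [inv_pow, Real.sq_sqrt h.le]
    have hle : sminSq A ≤ (sqnorm v)⁻¹ * sqnorm (A.mulVec v) := by
      refine csInf_le ⟨0, ?_⟩ ⟨(√(sqnorm v))⁻¹ • v, ?_, ?_⟩
      · rintro _ ⟨w, -, rfl⟩
        exact sqnorm_nonneg _
      · rw [sqnorm_smul, hc, inv_mul_cancel₀ h.ne']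
      · rw [Matrix.mulVec_smul, sqnorm_smul, hc]
    calc sminSq A * sqnorm v ≤ (sqnorm v)⁻¹ * sqnorm (A.mulVec v) * sqnorm v := by gcongr
      _ = sqnorm (A.mulVec v) := by field_simp

/-- Orthogonal projection along a row `a` decreases the squared error by `⟨a, e⟩² / ‖a‖²`. -/
lemma sqnorm_mul_sqnorm_projection {l : ℕ} (a e : Fin l → ℝ) :
    sqnorm a * sqnorm (e - (dotp a e / sqnorm a) • a) =
      sqnorm a * sqnorm e - dotp a e ^ 2 := by
  by_cases ha : sqnorm a = 0
  · have : a = 0 := sqnorm_eq_zero.1 ha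
    subst this
    simp [ha, dotp_eq_dotProduct]
  · have h : sqnorm (e - (dotp a e / sqnorm a) • a) =
        sqnorm e - 2 * (dotp a e / sqnorm a) * dotp a e
          + (dotp a e / sqnorm a) ^ 2 * sqnorm a := by
      simp only [sqnorm_eq_dotProduct, dotp_eq_dotProduct, sub_dotProduct, dotProduct_sub,
        smul_dotProduct, dotProduct_smul, smul_eq_mul, dotProduct_comm e a]
      ring
    rw [h]
    field_simp
    ring

/-- Expected error contraction of a randomized Kaczmarz step. -/
lemma sum_sqnorm_kaczmarz_le {m l : ℕ} {A : Matrix (Fin m) (Fin l) ℝ} (hA : 0 < frobSq A)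
    (yhat y : Fin l → ℝ) :
    ∑ j, sqnorm (A j) / frobSq A *
        sqnorm (y - ((dotp (A j) y - A.mulVec yhat j) / sqnorm (A j)) • A j - yhat)
      ≤ (1 - sminSq A / frobSq A) * sqnorm (y - yhat) := by
  have hterm : ∀ j, sqnorm (A j) / frobSq A *
      sqnorm (y - ((dotp (A j) y - A.mulVec yhat j) / sqnorm (A j)) • A j - yhat) =
      sqnorm (A j) / frobSq A * sqnorm (y - yhat) - A.mulVec (y - yhat) j ^ 2 / frobSq A := by
    intro j
    have h1 : dotp (A j) y - A.mulVec yhat j = dotp (A j) (y - yhat) := by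
      simp only [dotp_eq_dotProduct, dotProduct_sub]
      rfl
    have h2 : A.mulVec (y - yhat) j = dotp (A j) (y - yhat) := rfl
    rw [h1, h2, sub_right_comm, div_mul_eq_mul_div, sqnorm_mul_sqnorm_projection]
    ring
  rw [Finset.sum_congr rfl fun j _ => hterm j, Finset.sum_sub_distrib, ← Finset.sum_mul,
    sum_sqnorm_div_frobSq hA, ← Finset.sum_div]
  have h := sminSq_mul_sqnorm_le A (y - yhat)
  have h' : sminSq A * sqnorm (y - yhat) / frobSq A ≤
      (∑ j, A.mulVec (y - yhat) j ^ 2) / frobSq A := by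
    gcongr
    exact h
  calc _ ≤ 1 * sqnorm (y - yhat) - sminSq A * sqnorm (y - yhat) / frobSq A := by linarith
    _ = _ := by ring

lemma one_sub_sminSq_div_nonneg {m l : ℕ} [NeZero l] {A : Matrix (Fin m) (Fin l) ℝ}
    (hA : 0 < frobSq A) : 0 ≤ 1 - sminSq A / frobSq A := by
  have h := sum_sqnorm_kaczmarz_le hA 0 (Pi.single 0 1)
  have hs : sqnorm ((Pi.single 0 1 : Fin l → ℝ) - 0) = 1 := by
    simp [sqnorm_eq_dotProduct]
  rw [hs, mul_one] at h
  refine le_trans (Finset.sum_nonneg fun j _ => ?_) h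
  exact mul_nonneg (div_nonneg (sqnorm_nonneg _) hA.le) (sqnorm_nonneg _)

/-- Descent inequality for the Bregman distance under a perturbation of the subgradient. -/
lemma Dbreg_le_add {n : ℕ} {f : (Fin n → ℝ) → ℝ} {γ : ℝ} (hγ : 0 < γ)
    (hsc : StrongConvexWith γ f) {x z : Fin n → ℝ} (hz : z ∈ subdiff f x)
    (x' z' xs : Fin n → ℝ) :
    Dbreg f z' x' xs ≤ Dbreg f z x xs + dotp (z' - z) (x - xs)
      + 1 / (2 * γ) * sqnorm (z' - z) := by
  have h := hsc x x' z hz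
  have hy : 0 ≤ 1 / (2 * γ) * sqnorm ((z' - z) - γ • (x' - x)) :=
    mul_nonneg (by positivity) (sqnorm_nonneg _)
  have hexp : 1 / (2 * γ) * sqnorm ((z' - z) - γ • (x' - x)) =
      1 / (2 * γ) * sqnorm (z' - z) - dotp (z' - z) (x' - x) + γ / 2 * sqnorm (x' - x) := by
    have : sqnorm ((z' - z) - γ • (x' - x)) =
        sqnorm (z' - z) - 2 * γ * dotp (z' - z) (x' - x) + γ ^ 2 * sqnorm (x' - x) := by
      generalize z' - z = p
      generalize x' - x = q
      simp only [sqnorm_eq_dotProduct, dotp_eq_dotProduct, sub_dotProduct, dotProduct_sub,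
        smul_dotProduct, dotProduct_smul, smul_eq_mul, dotProduct_comm q p]
      ring
    rw [this]
    field_simp
  rw [hexp] at hy
  simp only [Dbreg, dotp_eq_dotProduct, sub_dotProduct, dotProduct_sub] at *
  linarith

lemma Dbreg_nonneg {n : ℕ} {f : (Fin n → ℝ) → ℝ} {x z : Fin n → ℝ} (hz : z ∈ subdiff f x)
    (y : Fin n → ℝ) : 0 ≤ Dbreg f z x y := by
  have := hz y
  simp only [Dbreg]
  linarith

lemma eq_of_Dbreg_nonpos {n : ℕ} {f : (Fin n → ℝ) → ℝ} {γ : ℝ} (hγ : 0 < γ)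
    (hsc : StrongConvexWith γ f) {x y z : Fin n → ℝ} (hz : z ∈ subdiff f x)
    (h : Dbreg f z x y ≤ 0) : y = x := by
  have h1 := hsc x y z hz
  have h2 := sqnorm_nonneg (y - x)
  simp only [Dbreg] at h
  have h3 : γ / 2 * sqnorm (y - x) ≤ 0 := by linarith
  have h4 : sqnorm (y - x) = 0 := by
    refine le_antisymm ?_ h2
    by_contra! h5
    have : 0 < γ / 2 * sqnorm (y - x) := by positivity
    linarith
  exact sub_eq_zero.1 (sqnorm_eq_zero.1 h4)

/-- A real-valued function cannot have all multiples of a nonzero vector as subgradients at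
one point. -/
lemma exists_smul_notMem_subdiff {n : ℕ} (f : (Fin n → ℝ) → ℝ) (x : Fin n → ℝ)
    {w : Fin n → ℝ} (hw : w ≠ 0) : ∃ t : ℝ, t • w ∉ subdiff f x := by
  by_contra! h
  have hpos : 0 < sqnorm w :=
    lt_of_le_of_ne (sqnorm_nonneg _) fun h => hw (sqnorm_eq_zero.1 h.symm)
  have := h ((f (x + w) - f x + 1) / sqnorm w) (x + w)
  rw [add_sub_cancel_left, dotp_eq_dotProduct, smul_dotProduct, ← sqnorm_eq_dotProduct,
    smul_eq_mul, div_mul_cancel₀ _ hpos.ne'] at this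
  linarith

section Descent

variable {l n : ℕ} {B : Matrix (Fin l) (Fin n) ℝ} {f : (Fin n → ℝ) → ℝ} {γ ν : ℝ}
  {Df : (Fin n → ℝ) → (Fin n → ℝ)} {xstar : Fin n → ℝ}

/-- Expected descent of a relaxed randomized regularized Kaczmarz step with inexact data `y`. -/
lemma sum_Dbreg_step_le (hB : 0 < frobSq B) (hγ : 0 < γ) (hsc : StrongConvexWith γ f)
    (hDf : ∀ x z, z ∈ subdiff f x ↔ x = Df z) (hν : 0 < ν)
    (hnu : ∀ x z, z ∈ subdiff f x → z ∈ Set.range Bᵀ.mulVec →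
      Dbreg f z x xstar ≤ (1 / ν) * sqnorm (B.mulVec (x - xstar)))
    {z : Fin n → ℝ} (hz : z ∈ Set.range Bᵀ.mulVec) (y : Fin l → ℝ) (g : Fin l → Fin n → ℝ)
    (hg : ∀ i, g i = z - (γ * (dotp (B i) (Df z) - y i) / sqnorm (B i)) • B i) :
    ∑ i, sqnorm (B i) / frobSq B * Dbreg f (g i) (Df (g i)) xstar
      ≤ (1 - γ * ν / (2 * frobSq B)) * Dbreg f z (Df z) xstar
        + γ / (2 * frobSq B) * sqnorm (y - B.mulVec xstar) := by
  have hzm : z ∈ subdiff f (Df z) := (hDf _ _).2 rfl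
  have hterm : ∀ i, sqnorm (B i) / frobSq B * Dbreg f (g i) (Df (g i)) xstar ≤
      sqnorm (B i) / frobSq B * Dbreg f z (Df z) xstar
        + γ / (2 * frobSq B) * ((y - B.mulVec xstar) i ^ 2
          - B.mulVec (Df z - xstar) i ^ 2) := by
    intro i
    have hs : B.mulVec (Df z - xstar) i = dotp (B i) (Df z) - B.mulVec xstar i := by
      rw [Matrix.mulVec_sub]
      rfl
    by_cases hBi : B i = 0
    · have h0 : sqnorm (B i) = 0 := sqnorm_eq_zero.2 hBi
      have h1 : B.mulVec (Df z - xstar) i = 0 := by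
        simp [Matrix.mulVec, hBi]
      rw [h0, h1]
      have : 0 ≤ γ / (2 * frobSq B) * (y - B.mulVec xstar) i ^ 2 := by positivity
      simpa using this
    · have hpos : 0 < sqnorm (B i) :=
        lt_of_le_of_ne (sqnorm_nonneg _) fun h => hBi (sqnorm_eq_zero.1 h.symm)
      have h := Dbreg_le_add hγ hsc hzm (Df (g i)) (g i) xstar
      have hd : g i - z = (-(γ * (dotp (B i) (Df z) - y i) / sqnorm (B i))) • B i := by
        rw [hg i, neg_smul]
        abel
      have hi : dotp (B i) (Df z - xstar) = B.mulVec (Df z - xstar) i := rfl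
      rw [hd, sqnorm_smul, dotp_eq_dotProduct, smul_dotProduct, ← dotp_eq_dotProduct, hi,
        smul_eq_mul] at h
      refine (mul_le_mul_of_nonneg_left h (div_nonneg hpos.le hB.le)).trans (le_of_eq ?_)
      rw [hs, Pi.sub_apply]
      field_simp
      ring
  refine (Finset.sum_le_sum fun i _ => hterm i).trans ?_
  rw [Finset.sum_add_distrib, ← Finset.sum_mul, sum_sqnorm_div_frobSq hB, ← Finset.mul_sum,
    Finset.sum_sub_distrib]
  have h := hnu _ _ hzm hz
  rw [one_div_mul_eq_div, le_div_iff₀ hν] at h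
  have h' : γ / (2 * frobSq B) * (Dbreg f z (Df z) xstar * ν) ≤
      γ / (2 * frobSq B) * ∑ i, B.mulVec (Df z - xstar) i ^ 2 := by
    gcongr
    exact h
  have e : ∑ i, (y - B.mulVec xstar) i ^ 2 = sqnorm (y - B.mulVec xstar) := rfl
  rw [e]
  have h2 : (1 - γ * ν / (2 * frobSq B)) * Dbreg f z (Df z) xstar =
      Dbreg f z (Df z) xstar - γ / (2 * frobSq B) * (Dbreg f z (Df z) xstar * ν) := by ring
  rw [h2]
  linarith

lemma smul_row_mem_range (B : Matrix (Fin l) (Fin n) ℝ) (t : ℝ) (i : Fin l) :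
    t • B i ∈ Set.range Bᵀ.mulVec := by
  refine ⟨t • Pi.single i 1, ?_⟩
  rw [Matrix.mulVec_smul, Matrix.mulVec_single_one]
  rfl

lemma one_sub_rate_nonneg {i : Fin l} (hi : B i ≠ 0) (hγ : 0 < γ)
    (hsc : StrongConvexWith γ f) (hDf : ∀ x z, z ∈ subdiff f x ↔ x = Df z) (hν : 0 < ν)
    (hnu : ∀ x z, z ∈ subdiff f x → z ∈ Set.range Bᵀ.mulVec →
      Dbreg f z x xstar ≤ (1 / ν) * sqnorm (B.mulVec (x - xstar))) :
    0 ≤ 1 - γ * ν / (2 * frobSq B) := by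
  by_contra! hneg
  have hB := frobSq_pos hi
  obtain ⟨t, ht⟩ := exists_smul_notMem_subdiff f xstar hi
  have hmem : t • B i ∈ subdiff f (Df (t • B i)) := (hDf _ _).2 rfl
  have h := sum_Dbreg_step_le hB hγ hsc hDf hν hnu (smul_row_mem_range B t i)
    (B.mulVec xstar) _ fun _ => rfl
  rw [sub_self, sqnorm_eq_zero.2 rfl, mul_zero, add_zero] at h
  have h0 := (Finset.sum_nonneg fun i' _ => mul_nonneg
    (div_nonneg (sqnorm_nonneg (B i')) hB.le) (Dbreg_nonneg ((hDf _ _).2 rfl) xstar)).trans h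
  have hD : Dbreg f (t • B i) (Df (t • B i)) xstar ≤ 0 := by
    by_contra! hlt
    exact absurd h0 (mul_neg_of_neg_of_pos hneg hlt).not_ge
  have := eq_of_Dbreg_nonpos hγ hsc hmem hD
  rw [this] at ht
  exact ht hmem

end Descent

section Expectation

variable {C S : Type*} [Fintype C]

/-- Expectation of `g` after `k` independent random steps with weights `w`. -/
def stepExp (w : C → ℝ) (iter : List C → S) (k : ℕ) (g : S → ℝ) : ℝ :=
  ∑ s : Fin k → C, (∏ t, w (s t)) * g (iter (List.ofFn s))

lemma stepExp_zero (w : C → ℝ) (iter : List C → S) (g : S → ℝ) :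
    stepExp w iter 0 g = g (iter []) := by
  simp [stepExp]

lemma stepExp_succ (w : C → ℝ) {iter : List C → S} {step : C → S → S}
    (hiter : ∀ c cs, iter (c :: cs) = step c (iter cs)) (k : ℕ) (g : S → ℝ) :
    stepExp w iter (k + 1) g = stepExp w iter k fun s => ∑ c, w c * g (step c s) := by
  unfold stepExp
  rw [← (Fin.consEquiv fun _ : Fin (k + 1) => C).sum_comp, Fintype.sum_prod_type,
    Finset.sum_comm]
  refine Finset.sum_congr rfl fun s _ => ?_
  rw [Finset.mul_sum]
  refine Finset.sum_congr rfl fun c _ => ?_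
  simp only [Fin.consEquiv_apply, Fin.prod_univ_succ, Fin.cons_zero, Fin.cons_succ,
    List.ofFn_succ, hiter]
  ring

lemma stepExp_mono {w : C → ℝ} (hw : ∀ c, 0 ≤ w c) {iter : List C → S} {k : ℕ} {g h : S → ℝ}
    (hgh : ∀ cs, g (iter cs) ≤ h (iter cs)) : stepExp w iter k g ≤ stepExp w iter k h :=
  Finset.sum_le_sum fun _ _ =>
    mul_le_mul_of_nonneg_left (hgh _) (Finset.prod_nonneg fun _ _ => hw _)

lemma stepExp_linear (w : C → ℝ) (iter : List C → S) (k : ℕ) (a b : ℝ) (g h : S → ℝ) :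
    stepExp w iter k (fun s => a * g s + b * h s) =
      a * stepExp w iter k g + b * stepExp w iter k h := by
  simp only [stepExp, Finset.mul_sum, ← Finset.sum_add_distrib]
  exact Finset.sum_congr rfl fun _ _ => by ring

/-- A coupled pair of expected contractions, unrolled. -/
lemma stepExp_le_of_coupled {w : C → ℝ} (hw : ∀ c, 0 ≤ w c) {iter : List C → S}
    {step : C → S → S} (hiter : ∀ c cs, iter (c :: cs) = step c (iter cs)) {U V : S → ℝ}
    {α β c : ℝ} (hα : 0 ≤ α) (hβ : 0 ≤ β) (hc : 0 ≤ c)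
    (hU : ∀ cs, ∑ d, w d * U (step d (iter cs)) ≤ α * U (iter cs))
    (hV : ∀ cs, ∑ d, w d * V (step d (iter cs)) ≤ β * V (iter cs) + c * α * U (iter cs))
    (k : ℕ) :
    stepExp w iter k U ≤ α ^ k * U (iter []) ∧
    stepExp w iter k V ≤ β ^ k * V (iter [])
      + c * U (iter []) * ∑ i ∈ Finset.range k, α ^ (k - i) * β ^ i := by
  induction k with
  | zero => simp [stepExp_zero]
  | succ k ih =>
    obtain ⟨ihU, ihV⟩ := ih
    rw [stepExp_succ w hiter, stepExp_succ w hiter]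
    constructor
    · calc _ ≤ stepExp w iter k (fun s => α * U s + 0 * U s) :=
            stepExp_mono hw fun cs => by simpa using hU cs
        _ = α * stepExp w iter k U := by rw [stepExp_linear]; ring
        _ ≤ α * (α ^ k * U (iter [])) := by gcongr
        _ = _ := by ring
    · calc _ ≤ stepExp w iter k (fun s => β * V s + c * α * U s) := stepExp_mono hw hV
        _ = β * stepExp w iter k V + c * α * stepExp w iter k U := stepExp_linear ..
        _ ≤ β * (β ^ k * V (iter [])
              + c * U (iter []) * ∑ i ∈ Finset.range k, α ^ (k - i) * β ^ i)
            + c * α * (α ^ k * U (iter [])) := by gcongr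
        _ = _ := by
          rw [Finset.sum_range_succ']
          have : ∑ i ∈ Finset.range k, α ^ (k + 1 - (i + 1)) * β ^ (i + 1) =
              β * ∑ i ∈ Finset.range k, α ^ (k - i) * β ^ i := by
            rw [Finset.mul_sum]
            refine Finset.sum_congr rfl fun i _ => ?_
            rw [Nat.add_sub_add_right]
            ring
          rw [this]
          simp only [Nat.sub_zero, pow_zero, mul_one]
          ring

end Expectation

lemma rkrrkIter_snd_mem_range {m l n : ℕ} (A : Matrix (Fin m) (Fin l) ℝ)
    (B : Matrix (Fin l) (Fin n) ℝ) (b : Fin m → ℝ) (γ : ℝ) (Df : (Fin n → ℝ) → (Fin n → ℝ))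
    (y0 : Fin l → ℝ) {z0 : Fin n → ℝ} (hz0 : z0 ∈ Set.range Bᵀ.mulVec)
    (cs : List (Fin m × Fin l)) :
    (rkrrkIter A B b γ Df y0 z0 cs).2 ∈ Set.range Bᵀ.mulVec := by
  induction cs with
  | nil => exact hz0
  | cons c cs ih =>
    obtain ⟨u, hu⟩ := ih
    obtain ⟨v, hv⟩ := smul_row_mem_range B (γ * (dotp (B c.2)
      (Df (rkrrkIter A B b γ Df y0 z0 cs).2) -
        (rkrrkIter A B b γ Df y0 z0 (c :: cs)).1 c.2) / sqnorm (B c.2)) c.2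
    refine ⟨u - v, ?_⟩
    rw [Matrix.mulVec_sub, hu, hv]
    rfl

/-- Convergence of the RK-RRK algorithm (Theorem 3.1): the
expectation over the random row choices of the Bregman distance of the `k`-th
iterate to `x⋆` satisfies the stated bound.  Here `Df = ∇f*` is characterized by
`z ∈ ∂f(x) ↔ x = Df z`, the `k`-th iterate is a function of the `k` independent
index choices `s : Fin k → Fin m × Fin l` (a pair `(j, i)` being chosen with
probability `(‖A_{j,:}‖²/‖A‖_F²)·(‖B_{i,:}‖²/‖B‖_F²)`), and `x^{(k)} = Df z^{(k)}`. -/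
theorem rk_rrk_convergence {m l n : ℕ}
    (A : Matrix (Fin m) (Fin l) ℝ) (B : Matrix (Fin l) (Fin n) ℝ)
    (b : Fin m → ℝ) (Adag : Matrix (Fin l) (Fin m) ℝ)
    (hA : A.rank = l) (hB : B.rank = l) (hAdag : IsMoorePenrose A Adag)
    (hb : ∃ x, (A * B).mulVec x = b)
    (f : (Fin n → ℝ) → ℝ) (γ : ℝ) (hγ : 0 < γ) (hsc : StrongConvexWith γ f)
    (Df : (Fin n → ℝ) → (Fin n → ℝ)) (hDf : ∀ x z, z ∈ subdiff f x ↔ x = Df z)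
    (xstar : Fin n → ℝ) (hfeas : (A * B).mulVec xstar = b)
    (hmin : ∀ x, (A * B).mulVec x = b → f xstar ≤ f x)
    (ν : ℝ) (hν : 0 < ν)
    (hnu : ∀ x z, z ∈ subdiff f x → z ∈ Set.range Bᵀ.mulVec →
      Dbreg f z x xstar ≤ (1 / ν) * sqnorm (B.mulVec (x - xstar)))
    (z0 : Fin n → ℝ) (hz0 : z0 ∈ Set.range Bᵀ.mulVec)
    (δ : ℝ) (hδ : 0 < δ) (k : ℕ) (hk : 1 ≤ k) :
    ∑ s : Fin k → Fin m × Fin l,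
        (∏ t, (sqnorm (A (s t).1) / frobSq A) * (sqnorm (B (s t).2) / frobSq B)) *
          Dbreg f (rkrrkIter A B b γ Df 0 z0 (List.ofFn s)).2
            (Df (rkrrkIter A B b γ Df 0 z0 (List.ofFn s)).2) xstar
      ≤ (1 + δ / γ) ^ k * (1 - γ * ν / (2 * frobSq B)) ^ k * Dbreg f z0 (Df z0) xstar
        + (δ + γ) * γ / (2 * δ * frobSq B) * sqnorm (Adag.mulVec b) *
          ∑ i ∈ Finset.range k,
            (1 - sminSq A / frobSq A) ^ (k - i) * (1 + δ / γ) ^ i *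
              (1 - γ * ν / (2 * frobSq B)) ^ i := by
  rcases Nat.eq_zero_or_pos l with rfl | hl
  · have : Nonempty (Fin k) := ⟨⟨0, hk⟩⟩
    have hD : 0 ≤ Dbreg f z0 (Df z0) xstar := Dbreg_nonneg ((hDf _ _).2 rfl) xstar
    have hF : frobSq B = 0 := by simp [frobSq]
    simp only [Finset.univ_eq_empty, Finset.sum_empty, hF, mul_zero, div_zero, sub_zero,
      one_pow, mul_one, zero_mul, add_zero]
    positivity
  have : NeZero l := ⟨hl.ne'⟩
  obtain ⟨jA, hjA⟩ := exists_row_ne_zero hA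
  obtain ⟨iB, hiB⟩ := exists_row_ne_zero hB
  have hAF := frobSq_pos hjA
  have hBF := frobSq_pos hiB
  have hα := one_sub_sminSq_div_nonneg hAF
  have hβ := one_sub_rate_nonneg hiB hγ hsc hDf hν hnu
  have hAy : A.mulVec (B.mulVec xstar) = b := by rw [Matrix.mulVec_mulVec, hfeas]
  have hAb : Adag.mulVec b = B.mulVec xstar := by rw [← hAy, hAdag.mulVec_mulVec hA]
  have hD : 0 ≤ Dbreg f z0 (Df z0) xstar := Dbreg_nonneg ((hDf _ _).2 rfl) xstar
  have hq := sum_sqnorm_div_frobSq hBF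
  set α := 1 - sminSq A / frobSq A
  set β := 1 - γ * ν / (2 * frobSq B)
  set y' : Fin m → (Fin l → ℝ) → Fin l → ℝ :=
    fun j y => y - ((dotp (A j) y - b j) / sqnorm (A j)) • A j
  have hRK : ∀ y, ∑ j, sqnorm (A j) / frobSq A * sqnorm (y' j y - B.mulVec xstar) ≤
      α * sqnorm (y - B.mulVec xstar) := by
    intro y
    have := sum_sqnorm_kaczmarz_le hAF (B.mulVec xstar) y
    rwa [hAy] at this
  have key := (stepExp_le_of_coupled
    (w := fun c : Fin m × Fin l => sqnorm (A c.1) / frobSq A * (sqnorm (B c.2) / frobSq B))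
    (fun c => mul_nonneg (div_nonneg (sqnorm_nonneg _) hAF.le)
      (div_nonneg (sqnorm_nonneg _) hBF.le))
    (iter := rkrrkIter A B b γ Df 0 z0) (step := rkrrkStep A B b γ Df) (fun _ _ => rfl)
    (U := fun s => sqnorm (s.1 - B.mulVec xstar)) (V := fun s => Dbreg f s.2 (Df s.2) xstar)
    (c := γ / (2 * frobSq B)) hα hβ (by positivity) ?_ ?_ k).2
  · have hU0 : sqnorm ((0 : Fin l → ℝ) - B.mulVec xstar) = sqnorm (Adag.mulVec b) := by
      rw [hAb, zero_sub, ← neg_one_smul ℝ, sqnorm_smul]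
      ring
    have hr : 1 ≤ 1 + δ / γ := by
      have : 0 < δ / γ := by positivity
      linarith
    have hC : γ / (2 * frobSq B) ≤ (δ + γ) * γ / (2 * δ * frobSq B) := by
      rw [div_le_div_iff₀ (by positivity) (by positivity)]
      have : 0 < γ * γ * frobSq B := by positivity
      nlinarith
    have hS : 0 ≤ sqnorm (Adag.mulVec b) := sqnorm_nonneg _
    refine key.trans ?_
    simp only [rkrrkIter, hU0]
    refine add_le_add ?_ (mul_le_mul (mul_le_mul_of_nonneg_right hC hS)
      (Finset.sum_le_sum fun i _ => ?_) (Finset.sum_nonneg fun i _ => by positivity)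
      (by positivity))
    · refine mul_le_mul_of_nonneg_right ?_ hD
      exact le_mul_of_one_le_left (by positivity) (one_le_pow₀ hr)
    · refine mul_le_mul_of_nonneg_right ?_ (by positivity)
      exact le_mul_of_one_le_right (by positivity) (one_le_pow₀ hr)
  · intro cs
    refine le_trans (le_of_eq ?_) (hRK (rkrrkIter A B b γ Df 0 z0 cs).1)
    rw [Fintype.sum_prod_type]
    refine Finset.sum_congr rfl fun j _ => ?_
    calc _ = ∑ i, sqnorm (B i) / frobSq B * (sqnorm (A j) / frobSq A *
          sqnorm (y' j (rkrrkIter A B b γ Df 0 z0 cs).1 - B.mulVec xstar)) :=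
          Finset.sum_congr rfl fun i _ => by simp only [rkrrkStep, y']; ring
      _ = _ := by rw [← Finset.sum_mul, hq, one_mul]
  · intro cs
    set s := rkrrkIter A B b γ Df 0 z0 cs
    have hz : s.2 ∈ Set.range Bᵀ.mulVec := rkrrkIter_snd_mem_range A B b γ Df 0 hz0 cs
    rw [Fintype.sum_prod_type]
    calc _ = ∑ j, sqnorm (A j) / frobSq A * ∑ i, sqnorm (B i) / frobSq B *
          Dbreg f (rkrrkStep A B b γ Df (j, i) s).2
            (Df (rkrrkStep A B b γ Df (j, i) s).2) xstar := by
          refine Finset.sum_congr rfl fun j _ => ?_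
          rw [Finset.mul_sum]
          exact Finset.sum_congr rfl fun i _ => by ring
      _ ≤ ∑ j, sqnorm (A j) / frobSq A * (β * Dbreg f s.2 (Df s.2) xstar
            + γ / (2 * frobSq B) * sqnorm (y' j s.1 - B.mulVec xstar)) := by
          refine Finset.sum_le_sum fun j _ => mul_le_mul_of_nonneg_left ?_
            (div_nonneg (sqnorm_nonneg _) hAF.le)
          exact sum_Dbreg_step_le hBF hγ hsc hDf hν hnu hz (y' j s.1) _ fun _ => rfl
      _ = β * Dbreg f s.2 (Df s.2) xstar + γ / (2 * frobSq B) *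
            ∑ j, sqnorm (A j) / frobSq A * sqnorm (y' j s.1 - B.mulVec xstar) := by
          simp only [mul_add, Finset.sum_add_distrib]
          rw [← Finset.sum_mul, sum_sqnorm_div_frobSq hAF, one_mul, Finset.mul_sum]
          congr 1
          exact Finset.sum_congr rfl fun j _ => by ring
      _ ≤ β * Dbreg f s.2 (Df s.2) xstar + γ / (2 * frobSq B) *
            (α * sqnorm (s.1 - B.mulVec xstar)) := by
          gcongr
          exact hRK s.1
      _ = _ := by ring

end
end

section
/- Let C ∈ ℝ^{m×n}, b ∈ ℝ^m, λ > 0, and let {j_k}_{k≥1} ⊆ {1,…,n} and {i_k}_{k≥1} ⊆ {1,…,m} be arbitrary (deterministic) index sequences with C_{:,j_k} ≠ 0 and C_{i_k,:} ≠ 0. Define the GERK-(a,d) iterates by y^{(0)} = b, z^{(0)} ∈ ran(Cᵀ), x^{(0)} = S_λ(z^{(0)}), and for k ≥ 1: y^{(k)} = y^{(k−1)} − ((C_{:,j_k})ᵀ y^{(k−1)} / ‖C_{:,j_k}‖₂²) C_{:,j_k}, z^{(k)} = z^{(k−1)} − ((C_{i_k,:} x^{(k−1)} − b_{i_k} + y^{(k)}_{i_k})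 / ‖C_{i_k,:}‖₂²)(C_{i_k,:})ᵀ, x^{(k)} = S_λ(z^{(k)}). Define the RK-RSK iterates for the factorized system Â B̂ x = b̂ with = Cᵀ, B̂ = C, b̂ = Cᵀ b, using the same index sequences, by ŷ^{(0)} = 0, ẑ^{(0)} = z^{(0)}, x̂^{(0)} = S_λ(ẑ^{(0)}), and for k ≥ 1: ŷ^{(k)} = ŷ^{(k−1)} − ((Â_{j_k,:} ŷ^{(k−1)} − b̂_{j_k}) / ‖Â_{j_k,:}‖₂²)(Â_{j_k,:})ᵀ, ẑ^{(k)} = ẑ^{(k−1)} − ((B̂_{i_k,:} x̂^{(k−1)} − ŷ^{(k)}_{i_k}) / ‖B̂_{i_k,:}‖₂²)(B̂_{i_k,:})ᵀ, x̂^{(k)} = S_λ(ẑ^{(k)}). Then for all k ≥ 0: x^{(k)} = x̂^{(k)}, y^{(k)} = b − ŷ^{(k)}, and z^{(k)} = ẑ^{(k)}. -/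
open Finset Matrix

noncomputable section

/-- The soft shrinkage function, `(S_λ(x))_i = max{|x_i| − λ, 0}·sgn(x_i)`. -/
def Sshrink {k : ℕ} (lam : ℝ) (x : Fin k → ℝ) : Fin k → ℝ :=
  fun i => max (|x i| - lam) 0 * Real.sign (x i)

/-- The `y`-iterates of the GERK-(a,d) algorithm for `C x = b`:
`y⁰ = b`, `y^{(k)} = y^{(k−1)} − ((C_{:,j_k})ᵀ y^{(k−1)}/‖C_{:,j_k}‖₂²) C_{:,j_k}`. -/
def gerkY {m n : ℕ} (C : Matrix (Fin m) (Fin n) ℝ) (b : Fin m → ℝ)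
    (j : ℕ → Fin n) : ℕ → Fin m → ℝ
  | 0 => b
  | k + 1 =>
      gerkY C b j k -
        (dotp (Cᵀ (j (k + 1))) (gerkY C b j k) / sqnorm (Cᵀ (j (k + 1)))) • Cᵀ (j (k + 1))

/-- The `z`-iterates of the GERK-(a,d) algorithm for `C x = b` (with
`x^{(k)} = S_λ(z^{(k)})`). -/
def gerkZ {m n : ℕ} (C : Matrix (Fin m) (Fin n) ℝ) (b : Fin m → ℝ) (lam : ℝ)
    (j : ℕ → Fin n) (i : ℕ → Fin m) (z0 : Fin n → ℝ) : ℕ → Fin n → ℝ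
  | 0 => z0
  | k + 1 =>
      gerkZ C b lam j i z0 k -
        ((dotp (C (i (k + 1))) (Sshrink lam (gerkZ C b lam j i z0 k)) - b (i (k + 1)) +
            gerkY C b j (k + 1) (i (k + 1))) / sqnorm (C (i (k + 1)))) • C (i (k + 1))

/-- The `ŷ`-iterates of the RK-RSK algorithm for `Â B̂ x = b̂` with `Â = Cᵀ`,
`B̂ = C`, `b̂ = Cᵀ b`:  `ŷ⁰ = 0`,
`ŷ^{(k)} = ŷ^{(k−1)} − ((Â_{j_k,:} ŷ^{(k−1)} − b̂_{j_k})/‖Â_{j_k,:}‖₂²)(Â_{j_k,:})ᵀ`,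
where `Â_{j,:} = C_{:,j}`. -/
def hatY {m n : ℕ} (C : Matrix (Fin m) (Fin n) ℝ) (b : Fin m → ℝ)
    (j : ℕ → Fin n) : ℕ → Fin m → ℝ
  | 0 => 0
  | k + 1 =>
      hatY C b j k -
        ((dotp (Cᵀ (j (k + 1))) (hatY C b j k) - Cᵀ.mulVec b (j (k + 1))) /
            sqnorm (Cᵀ (j (k + 1)))) • Cᵀ (j (k + 1))

/-- The `ẑ`-iterates of the RK-RSK algorithm for `Â B̂ x = b̂` with `Â = Cᵀ`,
`B̂ = C`, `b̂ = Cᵀ b` (with `x̂^{(k)} = S_λ(ẑ^{(k)})`), where `B̂_{i,:} = C_{i,:}`. -/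
def hatZ {m n : ℕ} (C : Matrix (Fin m) (Fin n) ℝ) (b : Fin m → ℝ) (lam : ℝ)
    (j : ℕ → Fin n) (i : ℕ → Fin m) (z0 : Fin n → ℝ) : ℕ → Fin n → ℝ
  | 0 => z0
  | k + 1 =>
      hatZ C b lam j i z0 k -
        ((dotp (C (i (k + 1))) (Sshrink lam (hatZ C b lam j i z0 k)) -
            hatY C b j (k + 1) (i (k + 1))) / sqnorm (C (i (k + 1)))) • C (i (k + 1))

theorem dotp_sub_right {k : ℕ} (x y z : Fin k → ℝ) :
    dotp x (y - z) = dotp x y - dotp x z :=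
  dotProduct_sub x y z

theorem gerkY_eq_sub_hatY {m n : ℕ} (C : Matrix (Fin m) (Fin n) ℝ) (b : Fin m → ℝ)
    (j : ℕ → Fin n) (k : ℕ) : gerkY C b j k = b - hatY C b j k := by
  induction k with
  | zero => simp [gerkY, hatY]
  | succ k ih =>
    have h : Cᵀ.mulVec b (j (k + 1)) = dotp (Cᵀ (j (k + 1))) b := rfl
    rw [gerkY, hatY, ih, dotp_sub_right, h]
    ext l
    simp only [Pi.sub_apply, Pi.smul_apply, smul_eq_mul]
    ring

theorem gerkZ_eq_hatZ {m n : ℕ} (C : Matrix (Fin m) (Fin n) ℝ) (b : Fin m → ℝ) (lam : ℝ)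
    (j : ℕ → Fin n) (i : ℕ → Fin m) (z0 : Fin n → ℝ) (k : ℕ) :
    gerkZ C b lam j i z0 k = hatZ C b lam j i z0 k := by
  induction k with
  | zero => rfl
  | succ k ih =>
    rw [gerkZ, hatZ, ih, gerkY_eq_sub_hatY, Pi.sub_apply, sub_add_sub_cancel]

/-- The GERK-(a,d) algorithm for the full system `C x = b`
coincides with the RK-RSK algorithm for the factorized normal equations
`Â B̂ x = b̂` (`Â = Cᵀ`, `B̂ = C`, `b̂ = Cᵀ b`): for all `k`,
`x^{(k)} = x̂^{(k)}`, `y^{(k)} = b − ŷ^{(k)}`, and `z^{(k)} = ẑ^{(k)}`. -/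
theorem gerk_eq_rk_rsk {m n : ℕ}
    (C : Matrix (Fin m) (Fin n) ℝ) (b : Fin m → ℝ) (lam : ℝ) (hlam : 0 < lam)
    (j : ℕ → Fin n) (i : ℕ → Fin m)
    (hcols : ∀ k, Cᵀ (j k) ≠ 0) (hrows : ∀ k, C (i k) ≠ 0)
    (z0 : Fin n → ℝ) (hz0 : z0 ∈ Set.range Cᵀ.mulVec) :
    ∀ k : ℕ,
      Sshrink lam (gerkZ C b lam j i z0 k) = Sshrink lam (hatZ C b lam j i z0 k) ∧
      gerkY C b j k = b - hatY C b j k ∧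
      gerkZ C b lam j i z0 k = hatZ C b lam j i z0 k := by
  intro k
  have hZ := gerkZ_eq_hatZ C b lam j i z0 k
  exact ⟨congrArg _ hZ, gerkY_eq_sub_hatY C b j k, hZ⟩

end
end

section
/- Let f : ℝ^n → ℝ be γ-strongly convex with differentiable conjugate f*. Let z ∈ ℝ^n, x = ∇f*(z), and let x⋆ ∈ ℝ^n. Let c ∈ ℝ^n be a nonzero row vector (i.e., c = B_{i,:} for some matrix B with nonzero i-th row), set w = γ · c(x − x⋆)/‖c‖₂², ẑ = z − w cᵀ, and x̂ = ∇f*(ẑ). Then D_{f,ẑ}(x̂, x⋆) ≤ D_{f,z}(x, x⋆) − (γ/2) · |c(x − x⋆)|²/‖c‖₂². -/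
open Finset

noncomputable section

/-- Expansion of the nonnegative quantity `‖d + t c‖²`. -/
theorem sqnorm_add_smul_expand_nonneg {k : ℕ} (d c : Fin k → ℝ) (t : ℝ) :
    0 ≤ sqnorm d + 2 * t * dotp c d + t ^ 2 * sqnorm c := by
  have h : sqnorm d + 2 * t * dotp c d + t ^ 2 * sqnorm c = ∑ i, (d i + t * c i) ^ 2 := by
    simp only [sqnorm, dotp, Finset.mul_sum, ← Finset.sum_add_distrib]
    exact Finset.sum_congr rfl fun i _ => by ring
  rw [h]
  exact Finset.sum_nonneg fun i _ => sq_nonneg _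

theorem sqnorm_pos {k : ℕ} {c : Fin k → ℝ} (hc : c ≠ 0) : 0 < sqnorm c := by
  obtain ⟨i, hi⟩ := Function.ne_iff.mp hc
  exact Finset.sum_pos' (fun j _ => sq_nonneg _) ⟨i, Finset.mem_univ i, sq_pos_of_ne_zero hi⟩

/-- One step of the regularized Kaczmarz update decreases the
Bregman distance to `x⋆` by at least `(γ/2)|c(x−x⋆)|²/‖c‖₂²`.
Here `Df` is the gradient of the conjugate `f*`, characterized by
`z ∈ ∂f(x) ↔ x = Df z`. -/
theorem rrk_one_step_decrease {n : ℕ}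
    (f : (Fin n → ℝ) → ℝ) (γ : ℝ) (hγ : 0 < γ) (hsc : StrongConvexWith γ f)
    (Df : (Fin n → ℝ) → (Fin n → ℝ))
    (hDf : ∀ x z, z ∈ subdiff f x ↔ x = Df z)
    (z x xstar : Fin n → ℝ) (hx : x = Df z)
    (c : Fin n → ℝ) (hc : c ≠ 0)
    (w : ℝ) (hw : w = γ * dotp c (x - xstar) / sqnorm c)
    (zhat : Fin n → ℝ) (hzhat : zhat = z - w • c)
    (xhat : Fin n → ℝ) (hxhat : xhat = Df zhat) :
    Dbreg f zhat xhat xstar ≤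
      Dbreg f z x xstar - γ / 2 * (dotp c (x - xstar)) ^ 2 / sqnorm c := by
  have hstrong := hsc x xhat z ((hDf x z).2 hx)
  have hC := sqnorm_pos hc
  have hid : dotp z (xstar - x) - dotp z (xhat - x) - dotp zhat (xstar - xhat) =
      -w * dotp c (x - xstar) - w * dotp c (xhat - x) := by
    simp only [hzhat, dotp, Finset.mul_sum, ← Finset.sum_sub_distrib, Pi.sub_apply,
      Pi.smul_apply, smul_eq_mul]
    exact Finset.sum_congr rfl fun i _ => by ring
  have hsq := mul_nonneg (half_pos hγ).le
    (sqnorm_add_smul_expand_nonneg (xhat - x) c (dotp c (x - xstar) / sqnorm c))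
  have hw_mul : w * dotp c (xhat - x) =
      γ / 2 * (2 * (dotp c (x - xstar) / sqnorm c) * dotp c (xhat - x)) := by
    rw [hw]; ring
  have hw_self : w * dotp c (x - xstar) =
      2 * (γ / 2 * dotp c (x - xstar) ^ 2 / sqnorm c) := by
    rw [hw]; ring
  have hquad : γ / 2 * ((dotp c (x - xstar) / sqnorm c) ^ 2 * sqnorm c) =
      γ / 2 * dotp c (x - xstar) ^ 2 / sqnorm c := by
    field_simp
  unfold Dbreg
  linarith

end
end

section
/- Let B ∈ ℝ^{ℓ×n} with all rows nonzero, and let f : ℝ^n → ℝ be γ-strongly convex with differentiable conjugate f*. Let z ∈ ℝ^n, x = ∇f*(z), and x⋆ ∈ ℝ^n, and suppose D_{f,z}(x, x⋆) ≤ (1/ν)‖B(x − x⋆)‖₂² for some ν > 0. For each i ∈ {1,…,ℓ} define ẑ_i = z − γ (B_{i,:}(x − x⋆)/‖B_{i,:}‖₂²)(B_{i,:})ᵀ and x̂_i = ∇f*(ẑ_i). Then Σ_{i=1}^{ℓ} (‖B_{i,:}‖₂²/‖B‖_F²) · D_{f,ẑ_i}(x̂_i, x⋆) ≤ (1 − γν/(2‖B‖_F²))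 · D_{f,z}(x, x⋆). -/
open Finset

noncomputable section

theorem sqnorm_pos_of_ne_zero {k : ℕ} {b : Fin k → ℝ} (hb : b ≠ 0) : 0 < sqnorm b := by
  obtain ⟨j, hj⟩ := Function.ne_iff.mp hb
  exact Finset.sum_pos' (fun i _ => sq_nonneg _)
    ⟨j, Finset.mem_univ j, by simpa using sq_pos_of_ne_zero hj⟩

/-- Moving the subgradient by `-(γ * a) • b` decreases the Bregman distance by at least
`γ * a * (⟨b, x - y⟩ - a * ‖b‖² / 2)`. -/
theorem Dbreg_sub_smul_le {k : ℕ} {f : (Fin k → ℝ) → ℝ} {γ : ℝ} (hγ : 0 < γ)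
    (hsc : StrongConvexWith γ f) {x z : Fin k → ℝ} (hz : z ∈ subdiff f x)
    (b w y : Fin k → ℝ) (a : ℝ) :
    Dbreg f (z - (γ * a) • b) w y ≤
      Dbreg f z x y - γ * a * (dotp b (x - y) - a * sqnorm b / 2) := by
  have h := hsc x w z hz
  have hsq : 0 ≤ γ / 2 * ∑ i, (w i - x i + a * b i) ^ 2 :=
    mul_nonneg (by positivity) (Finset.sum_nonneg fun i _ => sq_nonneg _)
  have key : dotp z (w - x) + γ / 2 * sqnorm (w - x) + dotp (z - (γ * a) • b) (y - w)
      = dotp z (y - x) + γ * a * (dotp b (x - y) - a * sqnorm b / 2)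
        + γ / 2 * ∑ i, (w i - x i + a * b i) ^ 2 := by
    simp only [dotp, sqnorm, Pi.sub_apply, Pi.smul_apply, smul_eq_mul, mul_sub,
      Finset.mul_sum, Finset.sum_div, ← Finset.sum_add_distrib, ← Finset.sum_sub_distrib]
    exact Finset.sum_congr rfl fun i _ => by ring
  unfold Dbreg
  linarith

/-- Expected one-step contraction of the RRK update. -/
theorem rrk_expected_contraction {l n : ℕ}
    (B : Matrix (Fin l) (Fin n) ℝ) (hBrows : ∀ i, B i ≠ 0)
    (f : (Fin n → ℝ) → ℝ) (γ : ℝ) (hγ : 0 < γ) (hsc : StrongConvexWith γ f)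
    (Df : (Fin n → ℝ) → (Fin n → ℝ))
    (hDf : ∀ x z, z ∈ subdiff f x ↔ x = Df z)
    (z x xstar : Fin n → ℝ) (hx : x = Df z)
    (ν : ℝ) (hν : 0 < ν)
    (hbound : Dbreg f z x xstar ≤ (1 / ν) * sqnorm (B.mulVec (x - xstar))) :
    ∑ i, (sqnorm (B i) / frobSq B) *
        Dbreg f (z - (γ * (dotp (B i) (x - xstar) / sqnorm (B i))) • B i)
          (Df (z - (γ * (dotp (B i) (x - xstar) / sqnorm (B i))) • B i)) xstar
      ≤ (1 - γ * ν / (2 * frobSq B)) * Dbreg f z x xstar := by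
  have hz : z ∈ subdiff f x := (hDf x z).mpr hx
  have hD : 0 ≤ Dbreg f z x xstar := by
    have := hz xstar
    unfold Dbreg
    linarith
  have hpos : ∀ i, 0 < sqnorm (B i) := fun i => sqnorm_pos_of_ne_zero (hBrows i)
  have hF : frobSq B = ∑ i, sqnorm (B i) := rfl
  rcases Nat.eq_zero_or_pos l with rfl | hl
  · simpa [hF] using hD
  have hFpos : 0 < frobSq B := by
    rw [hF]
    exact Finset.sum_pos (fun i _ => hpos i) ⟨⟨0, hl⟩, Finset.mem_univ _⟩
  calc
    _ ≤ ∑ i, (sqnorm (B i) / frobSq B * Dbreg f z x xstar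
          - γ / (2 * frobSq B) * dotp (B i) (x - xstar) ^ 2) := by
      refine Finset.sum_le_sum fun i _ => ?_
      have hi := hpos i
      refine (mul_le_mul_of_nonneg_left (Dbreg_sub_smul_le hγ hsc hz (B i) _ xstar _)
        (by positivity)).trans_eq ?_
      field_simp
      ring
    _ = Dbreg f z x xstar - γ / (2 * frobSq B) * sqnorm (B.mulVec (x - xstar)) := by
      rw [Finset.sum_sub_distrib, ← Finset.sum_mul, ← Finset.sum_div, ← hF,
        div_self hFpos.ne', one_mul, ← Finset.mul_sum]
      rfl
    _ ≤ Dbreg f z x xstar - γ / (2 * frobSq B) * (ν * Dbreg f z x xstar) := by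
      have h : ν * Dbreg f z x xstar ≤ sqnorm (B.mulVec (x - xstar)) := by
        rwa [one_div, inv_mul_eq_div, le_div_iff₀' hν] at hbound
      gcongr
    _ = _ := by ring

end
end

section
/- Let f : ℝ^n → ℝ be γ-strongly convex with differentiable conjugate f*. Let z, ẑ ∈ ℝ^n, x = ∇f*(z), x̂ = ∇f*(ẑ), and let x⋆ ∈ ℝ^n. Then for every δ > 0, D_{f,z}(x, x⋆) ≤ (1 + δ/γ) · D_{f,ẑ}(x̂, x⋆) + ((δ + γ)/(2δγ)) · ‖z − ẑ‖₂². -/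
open Finset

noncomputable section

/-- Weighted Young inequality for the Euclidean inner product. -/
lemma dotp_le_young {k : ℕ} {c : ℝ} (hc : 0 < c) (a b : Fin k → ℝ) :
    dotp a b ≤ c / 2 * sqnorm b + 1 / (2 * c) * sqnorm a := by
  unfold dotp sqnorm
  rw [Finset.mul_sum, Finset.mul_sum, ← Finset.sum_add_distrib]
  refine Finset.sum_le_sum fun i _ => ?_
  have key : c / 2 * b i ^ 2 + 1 / (2 * c) * a i ^ 2 - a i * b i
      = (c * b i - a i) ^ 2 / (2 * c) := by
    field_simp
    ring
  have : 0 ≤ (c * b i - a i) ^ 2 / (2 * c) := by positivity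
  linarith

/-- Regrouping of the linear terms in the difference of two Bregman distances. -/
lemma dotp_sub_regroup {k : ℕ} (z w x y s : Fin k → ℝ) :
    dotp w (s - y) - dotp z (s - x) - dotp w (x - y)
      = dotp (w - z) (s - y) + dotp (z - w) (x - y) := by
  unfold dotp
  simp only [← Finset.sum_sub_distrib, ← Finset.sum_add_distrib, Pi.sub_apply]
  exact Finset.sum_congr rfl fun i _ => by ring

lemma sqnorm_sub_comm {k : ℕ} (x y : Fin k → ℝ) : sqnorm (x - y) = sqnorm (y - x) := by
  unfold sqnorm
  exact Finset.sum_congr rfl fun i _ => by simp only [Pi.sub_apply]; ring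

/-- Comparison of Bregman distances at two dual points. -/
theorem bregman_perturbation_bound {n : ℕ}
    (f : (Fin n → ℝ) → ℝ) (γ : ℝ) (hγ : 0 < γ) (hsc : StrongConvexWith γ f)
    (Df : (Fin n → ℝ) → (Fin n → ℝ))
    (hDf : ∀ x z, z ∈ subdiff f x ↔ x = Df z)
    (z zhat x xhat xstar : Fin n → ℝ) (hx : x = Df z) (hxhat : xhat = Df zhat)
    (δ : ℝ) (hδ : 0 < δ) :
    Dbreg f z x xstar ≤
      (1 + δ / γ) * Dbreg f zhat xhat xstar + (δ + γ) / (2 * δ * γ) * sqnorm (z - zhat) := by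
  have hstrong := hsc xhat x zhat ((hDf xhat zhat).2 hxhat)
  have hstar := hsc xhat xstar zhat ((hDf xhat zhat).2 hxhat)
  have hyδ := dotp_le_young hδ (zhat - z) (xstar - xhat)
  have hyγ := dotp_le_young hγ (z - zhat) (x - xhat)
  have hlin := dotp_sub_regroup z zhat x xhat xstar
  rw [sqnorm_sub_comm zhat z] at hyδ
  have hD : δ / 2 * sqnorm (xstar - xhat) ≤ δ / γ * Dbreg f zhat xhat xstar := by
    have hle : γ / 2 * sqnorm (xstar - xhat) ≤ Dbreg f zhat xhat xstar := by
      unfold Dbreg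
      linarith
    calc δ / 2 * sqnorm (xstar - xhat) = δ / γ * (γ / 2 * sqnorm (xstar - xhat)) := by
          field_simp
      _ ≤ _ := by gcongr
  have hcoef : (δ + γ) / (2 * δ * γ) * sqnorm (z - zhat)
      = 1 / (2 * δ) * sqnorm (z - zhat) + 1 / (2 * γ) * sqnorm (z - zhat) := by
    field_simp
    ring
  rw [hcoef, add_mul, one_mul]
  have hdiff : Dbreg f z x xstar - Dbreg f zhat xhat xstar
      = f xhat - f x + dotp zhat (xstar - xhat) - dotp z (xstar - x) := by
    unfold Dbreg
    ring
  linarith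

end
end
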